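/- arXiv:2405.02203 — 6 statements merged into one kernel-verified Lean document; each statement's English description precedes it below -/
import Mathlib

section
/- The germ G is L¹-dissipative: (i) for all (u_l,u_r) ∈ G one has f_l(u_l) = f_r(u_r) (Rankine–Hugoniot condition); (ii) for all (u_l,u_r) ∈ G and all (k_l,k_r) ∈ G one has Φ_l(u_l,k_l) − Φ_r(u_r,k_r) ≥ 0. -/
open Real Set

noncomputable section

/-- `f` is an increasing C¹-diffeomorphism of ℝ onto itself. -/
def IsIncrC1Diffeo (f : ℝ → ℝ) : Prop :=
  StrictMono f ∧ Function.Bijective f ∧ ContDiff ℝ 1 f ∧ ContDiff ℝ 1 (Function.invFun f)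

/-- `f ∈ C¹(ℝ,ℝ)`, `f'` is an increasing C¹-diffeomorphism of ℝ onto itself, and `α` is
the (unique) critical point, i.e. the unique minimizer, of the strictly convex function `f`. -/
def ConvexFlux (f : ℝ → ℝ) (α : ℝ) : Prop :=
  ContDiff ℝ 1 f ∧ IsIncrC1Diffeo (deriv f) ∧ deriv f α = 0

/-- The germ `G = G₁ ∪ G₂ ∪ G₃`.  A point `k_r` with `f_r k_r = y` and `k_r ≥ α_r`
(resp. `k_r ≤ α_r`) is exactly `S_r⁺ y` (resp. `S_r⁻ y`). -/
def germ (fl fr : ℝ → ℝ) (αl αr : ℝ) : Set (ℝ × ℝ) :=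
  {p | (αl ≤ p.1 ∧ αr ≤ p.2 ∧ fr p.2 = fl p.1) ∨
       (p.1 ≤ αl ∧ p.2 ≤ αr ∧ fr p.2 = fl p.1) ∨
       (αl < p.1 ∧ p.2 ≤ αr ∧ fr p.2 = fl p.1)}

/-- Kruzhkov entropy flux associated with `f`. -/
def PhiK (f : ℝ → ℝ) (a b : ℝ) : ℝ := Real.sign (a - b) * (f a - f b)

theorem ConvexFlux.strictMonoOn_Ici {f : ℝ → ℝ} {α : ℝ} (h : ConvexFlux f α) :
    StrictMonoOn f (Ici α) := by
  refine strictMonoOn_of_deriv_pos (convex_Ici α) h.1.continuous.continuousOn fun x hx => ?_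
  rw [interior_Ici] at hx
  exact h.2.2 ▸ h.2.1.1 hx

theorem ConvexFlux.strictAntiOn_Iic {f : ℝ → ℝ} {α : ℝ} (h : ConvexFlux f α) :
    StrictAntiOn f (Iic α) := by
  refine strictAntiOn_of_deriv_neg (convex_Iic α) h.1.continuous.continuousOn fun x hx => ?_
  rw [interior_Iic] at hx
  exact h.2.2 ▸ h.2.1.1 hx

theorem PhiK_comm (f : ℝ → ℝ) (a b : ℝ) : PhiK f a b = PhiK f b a := by
  unfold PhiK
  rw [← neg_sub b a, Real.sign_neg]
  ring

theorem flux_eq_of_mem_germ {fl fr : ℝ → ℝ} {αl αr : ℝ} {p : ℝ × ℝ}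
    (hp : p ∈ germ fl fr αl αr) : fl p.1 = fr p.2 := by
  rcases hp with h | h | h <;> exact h.2.2.symm

/-- A germ element with the larger flux lies to the right on the left side, or to the left on the
right side. -/
theorem lt_or_lt_of_flux_lt {fl fr : ℝ → ℝ} {αl αr : ℝ}
    (hfl : ConvexFlux fl αl) (hfr : ConvexFlux fr αr) {p k : ℝ × ℝ}
    (hp : p ∈ germ fl fr αl αr) (hk : k ∈ germ fl fr αl αr) (hlt : fl k.1 < fl p.1) :
    k.1 < p.1 ∨ p.2 < k.2 := by
  by_contra! hcon
  obtain ⟨h1, h2⟩ := hcon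
  have hpl : p.1 < αl := by
    by_contra! hge
    exact hlt.not_ge (hfl.strictMonoOn_Ici.monotoneOn hge (hge.trans h1) h1)
  have hpr : p.2 ≤ αr := by
    rcases hp with h | h | h
    · exact absurd hpl h.1.not_gt
    · exact h.2.1
    · exact h.2.1
  have hle := hfr.strictAntiOn_Iic.antitoneOn (h2.trans hpr) hpr h2
  rw [← flux_eq_of_mem_germ hp, ← flux_eq_of_mem_germ hk] at hle
  exact hlt.not_ge hle

theorem PhiK_le_of_flux_lt {fl fr : ℝ → ℝ} {αl αr : ℝ}
    (hfl : ConvexFlux fl αl) (hfr : ConvexFlux fr αr) {p k : ℝ × ℝ}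
    (hp : p ∈ germ fl fr αl αr) (hk : k ∈ germ fl fr αl αr) (hlt : fl k.1 < fl p.1) :
    PhiK fr p.2 k.2 ≤ PhiK fl p.1 k.1 := by
  unfold PhiK
  rw [← flux_eq_of_mem_germ hp, ← flux_eq_of_mem_germ hk]
  refine mul_le_mul_of_nonneg_right ?_ (sub_pos.2 hlt).le
  rcases lt_or_lt_of_flux_lt hfl hfr hp hk hlt with h | h
  · rw [Real.sign_of_pos (sub_pos.2 h)]
    rcases Real.sign_apply_eq (p.2 - k.2) with h | h | h <;> rw [h] <;> norm_num
  · rw [Real.sign_of_neg (sub_neg.2 h)]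
    rcases Real.sign_apply_eq (p.1 - k.1) with h | h | h <;> rw [h] <;> norm_num

/-- The germ `G` is L¹-dissipative: (i) Rankine–Hugoniot condition holds on `G`;
(ii) the dissipativity inequality holds for any two elements of `G`. -/
theorem germ_is_L1_dissipative (fl fr : ℝ → ℝ) (αl αr : ℝ)
    (hfl : ConvexFlux fl αl) (hfr : ConvexFlux fr αr) :
    (∀ p ∈ germ fl fr αl αr, fl p.1 = fr p.2) ∧
    (∀ p ∈ germ fl fr αl αr, ∀ k ∈ germ fl fr αl αr,
      PhiK fl p.1 k.1 - PhiK fr p.2 k.2 ≥ 0) := by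
  refine ⟨fun p hp => flux_eq_of_mem_germ hp, fun p hp k hk => sub_nonneg.2 ?_⟩
  rcases lt_trichotomy (fl k.1) (fl p.1) with h | h | h
  · exact PhiK_le_of_flux_lt hfl hfr hp hk h
  · simp [PhiK, ← flux_eq_of_mem_germ hp, ← flux_eq_of_mem_germ hk, h]
  · rw [PhiK_comm fl, PhiK_comm fr]
    exact PhiK_le_of_flux_lt hfl hfr hk hp h
end
end

section
/- For all (u_l,u_r) ∈ ℝ²: (u_l,u_r) ∈ G if and only if R(u_l,u_r) = 0. -/
open Real Set

noncomputable section

/-- The interface flux `F_int(u_l,u_r) = max{f_l(u_l ∨ α_l), f_r(α_r ∧ u_r)}`. -/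
def Fint (fl fr : ℝ → ℝ) (αl αr : ℝ) (ul ur : ℝ) : ℝ :=
  max (fl (max ul αl)) (fr (min αr ur))

/-- The remainder term `R(u_l,u_r)`. -/
def Rem (fl fr : ℝ → ℝ) (αl αr : ℝ) (ul ur : ℝ) : ℝ :=
  |Fint fl fr αl αr ul ur - fl ul| + |Fint fl fr αl αr ul ur - fr ur|

/-- A convex flux takes its minimum only at its critical point. -/
theorem ConvexFlux.apply_lt {f : ℝ → ℝ} {α : ℝ} (h : ConvexFlux f α) {u : ℝ} (hu : u ≠ α) :
    f α < f u := by
  obtain ⟨hf, ⟨hmono, -⟩, hα⟩ := h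
  rcases hu.lt_or_gt with hu | hu
  · refine strictAntiOn_of_deriv_neg (convex_Iic α) hf.continuous.continuousOn
      (fun x hx => ?_) hu.le self_mem_Iic hu
    rw [interior_Iic] at hx
    exact hα ▸ hmono hx
  · refine strictMonoOn_of_deriv_pos (convex_Ici α) hf.continuous.continuousOn
      (fun x hx => ?_) self_mem_Ici hu.le hu
    rw [interior_Ici] at hx
    exact hα ▸ hmono hx

theorem ConvexFlux.apply_le {f : ℝ → ℝ} {α : ℝ} (h : ConvexFlux f α) (u : ℝ) : f α ≤ f u := by
  rcases eq_or_ne u α with rfl | hu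
  · exact le_rfl
  · exact (h.apply_lt hu).le

/-- The remainder vanishes exactly when both one-sided fluxes equal the interface flux. -/
theorem rem_eq_zero_iff (fl fr : ℝ → ℝ) (αl αr ul ur : ℝ) :
    Rem fl fr αl αr ul ur = 0 ↔
      Fint fl fr αl αr ul ur = fl ul ∧ Fint fl fr αl αr ul ur = fr ur := by
  rw [Rem, add_eq_zero_iff_of_nonneg (abs_nonneg _) (abs_nonneg _), abs_eq_zero, abs_eq_zero,
    sub_eq_zero, sub_eq_zero]

/-- `(u_l,u_r) ∈ G` if and only if `R(u_l,u_r) = 0`. -/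
theorem mem_germ_iff_rem_eq_zero (fl fr : ℝ → ℝ) (αl αr : ℝ)
    (hfl : ConvexFlux fl αl) (hfr : ConvexFlux fr αr) (ul ur : ℝ) :
    (ul, ur) ∈ germ fl fr αl αr ↔ Rem fl fr αl αr ul ur = 0 := by
  rw [rem_eq_zero_iff]
  constructor
  · rintro (⟨hl, hr, h⟩ | ⟨hl, hr, h⟩ | ⟨hl, hr, h⟩) <;> dsimp only at hl hr h
    · have hle : fr αr ≤ fl ul := h ▸ hfr.apply_le ur
      rw [Fint, max_eq_left hl, min_eq_left hr, max_eq_left hle]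
      exact ⟨rfl, h.symm⟩
    · have hle : fl αl ≤ fr ur := h ▸ hfl.apply_le ul
      rw [Fint, max_eq_right hl, min_eq_right hr, max_eq_right hle]
      exact ⟨h, rfl⟩
    · rw [Fint, max_eq_left hl.le, min_eq_right hr, h, max_self]
      exact ⟨rfl, rfl⟩
  · rintro ⟨hl, hr⟩
    have h : fr ur = fl ul := hr.symm.trans hl
    rcases le_or_gt ur αr with hur | hur
    · rcases le_or_gt ul αl with hul | hul
      · exact Or.inr (Or.inl ⟨hul, hur, h⟩)
      · exact Or.inr (Or.inr ⟨hul, hur, h⟩)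
    · rcases le_or_gt αl ul with hul | hul
      · exact Or.inl ⟨hul, hur.le, h⟩
      · have hlt : Fint fl fr αl αr ul ur < fl ul := by
          rw [Fint, max_eq_right hul.le, min_eq_left hur.le]
          exact max_lt (hfl.apply_lt hul.ne) (h ▸ hfr.apply_lt hur.ne')
        exact absurd hl hlt.ne
end
end

section
/- For all (u_l,u_r) ∈ ℝ² and all (k_l,k_r) ∈ G: Φ_r(u_r,k_r) − Φ_l(u_l,k_l) ≤ R(u_l,u_r). -/
open Real Set

noncomputable section

theorem ConvexFlux.monotoneOn {f : ℝ → ℝ} {α : ℝ} (hf : ConvexFlux f α) :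
    MonotoneOn f (Ici α) := by
  obtain ⟨hC, ⟨hmono, -⟩, hα⟩ := hf
  refine monotoneOn_of_deriv_nonneg (convex_Ici α) hC.continuous.continuousOn
    (hC.differentiable one_ne_zero).differentiableOn fun x hx => ?_
  rw [interior_Ici] at hx
  exact hα ▸ hmono.monotone (mem_Ioi.1 hx).le

theorem ConvexFlux.antitoneOn {f : ℝ → ℝ} {α : ℝ} (hf : ConvexFlux f α) :
    AntitoneOn f (Iic α) := by
  obtain ⟨hC, ⟨hmono, -⟩, hα⟩ := hf
  refine antitoneOn_of_deriv_nonpos (convex_Iic α) hC.continuous.continuousOn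
    (hC.differentiable one_ne_zero).differentiableOn fun x hx => ?_
  rw [interior_Iic] at hx
  exact hα ▸ hmono.monotone (mem_Iio.1 hx).le

theorem ConvexFlux.le_apply {f : ℝ → ℝ} {α : ℝ} (hf : ConvexFlux f α) (x : ℝ) : f α ≤ f x := by
  rcases le_total α x with h | h
  · exact hf.monotoneOn self_mem_Ici h h
  · exact hf.antitoneOn h self_mem_Iic h

section InterfaceFlux

variable {fl fr : ℝ → ℝ} {αl αr ul ur : ℝ} {k : ℝ × ℝ}

theorem apply_snd_eq_of_mem_germ (hk : k ∈ germ fl fr αl αr) : fr k.2 = fl k.1 := by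
  rcases hk with h | h | h <;> exact h.2.2

theorem apply_max_le (hfl : ConvexFlux fl αl) {x y : ℝ} (h : x ≤ y) : fl (max x αl) ≤ fl y := by
  rcases le_total αl y with hy | hy
  · exact hfl.monotoneOn (le_max_right x αl) hy (max_le h hy)
  · rw [max_eq_right (h.trans hy)]
    exact hfl.le_apply y

theorem apply_min_le (hfr : ConvexFlux fr αr) {x y : ℝ} (h : y ≤ x) : fr (min αr x) ≤ fr y := by
  rcases le_total y αr with hy | hy
  · exact hfr.antitoneOn hy (min_le_left αr x) (le_min hy h)
  · rw [min_eq_left (hy.trans h)]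
    exact hfr.le_apply y

theorem Fint_le_of_mem_germ (hfl : ConvexFlux fl αl) (hfr : ConvexFlux fr αr)
    (hk : k ∈ germ fl fr αl αr) (hl : ul ≤ k.1) (hr : k.2 ≤ ur) :
    Fint fl fr αl αr ul ur ≤ fl k.1 :=
  max_le (apply_max_le hfl hl) (apply_snd_eq_of_mem_germ hk ▸ apply_min_le hfr hr)

theorem le_Fint_of_mem_germ (hfl : ConvexFlux fl αl) (hfr : ConvexFlux fr αr)
    (hk : k ∈ germ fl fr αl αr) (hl : k.1 ≤ ul) (hr : ur ≤ k.2) :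
    fl k.1 ≤ Fint fl fr αl αr ul ur := by
  have hcases : αl ≤ k.1 ∨ k.2 ≤ αr := by
    rcases hk with h | h | h
    · exact Or.inl h.1
    · exact Or.inr h.2.1
    · exact Or.inr h.2.1
  rcases hcases with h | h
  · refine le_max_of_le_left ?_
    rw [max_eq_left (h.trans hl)]
    exact hfl.monotoneOn h (h.trans hl) hl
  · refine le_max_of_le_right ?_
    rw [min_eq_right (hr.trans h), ← apply_snd_eq_of_mem_germ hk]
    exact hfr.antitoneOn (hr.trans h) h hr

end InterfaceFlux

/-- For all `(u_l,u_r) ∈ ℝ²` and all `(k_l,k_r) ∈ G`: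
`Φ_r(u_r,k_r) − Φ_l(u_l,k_l) ≤ R(u_l,u_r)`. -/
theorem entropy_defect_le_rem (fl fr : ℝ → ℝ) (αl αr : ℝ)
    (hfl : ConvexFlux fl αl) (hfr : ConvexFlux fr αr)
    (ul ur : ℝ) (k : ℝ × ℝ) (hk : k ∈ germ fl fr αl αr) :
    PhiK fr ur k.2 - PhiK fl ul k.1 ≤ Rem fl fr αl αr ul ur := by
  have hy := apply_snd_eq_of_mem_germ hk
  have hle := Fint_le_of_mem_germ (ul := ul) (ur := ur) hfl hfr hk
  have hge := le_Fint_of_mem_germ (ul := ul) (ur := ur) hfl hfr hk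
  unfold PhiK Rem
  rw [hy]
  generalize Fint fl fr αl αr ul ur = F at *
  have hl₁ := le_abs_self (F - fl ul)
  have hl₂ := neg_abs_le (F - fl ul)
  have hr₁ := le_abs_self (F - fr ur)
  have hr₂ := neg_abs_le (F - fr ur)
  rcases lt_trichotomy ul k.1 with hl | hl | hl <;>
    rcases lt_trichotomy ur k.2 with hr | hr | hr <;>
    simp only [hl, hr, sub_self, Real.sign_zero, Real.sign_of_neg, Real.sign_of_pos, sub_neg,
      sub_pos, le_refl, hl.le, hr.le, forall_const] at * <;>
    linarith
end
end

section
/- Assume H : ℝ² → ℝ satisfies (C3), (CH) and (CVX). For every k ∈ ℝ there exists a constant μ_k > 0, depending only on H and k (in particular independent of Δx and j), such that for every Δx > 0 and every j ∈ ℤ: |F^{j+1/2}(k,k) − H(x_{j+1},k)| ≤ μ_k Δx. -/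
open Real Set MeasureTheory Filter

noncomputable section

/-- (C3): `H ∈ C³(ℝ²,ℝ)`. -/
def FluxC3 (H : ℝ → ℝ → ℝ) : Prop := ContDiff ℝ 3 (Function.uncurry H)

/-- (CH): compact heterogeneity with threshold `X`: `∂ₓH(x,u) = 0` whenever `|x| ≥ X`. -/
def FluxCH (H : ℝ → ℝ → ℝ) (X : ℝ) : Prop :=
  0 < X ∧ ∀ x u : ℝ, X ≤ |x| → deriv (fun y => H y u) x = 0

/-- (CVX): for every `x`, `u ↦ ∂ᵤH(x,u)` is an increasing C¹-diffeomorphism of ℝ onto itself. -/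
def FluxCVX (H : ℝ → ℝ → ℝ) : Prop := ∀ x : ℝ, IsIncrC1Diffeo (deriv (H x))

/-- The interface flux `F^{j+1/2}(a,b) = max{h_j(a ∨ α_j), h_{j+1}(α_{j+1} ∧ b)}`,
where `x_j = jΔx`, `h_j = H(x_j,·)` and `α_j = α(x_j)`. -/
def iflux (H : ℝ → ℝ → ℝ) (α : ℝ → ℝ) (Δx : ℝ) (j : ℤ) (a b : ℝ) : ℝ :=
  max (H ((j : ℝ) * Δx) (max a (α ((j : ℝ) * Δx))))
    (H (((j : ℝ) + 1) * Δx) (min (α (((j : ℝ) + 1) * Δx)) b))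

/-- The tangent line of a differentiable function with monotone derivative lies below its graph. -/
theorem tangent_le_of_monotone_deriv {f : ℝ → ℝ} (hf : Differentiable ℝ f)
    (hmono : Monotone (deriv f)) (a b : ℝ) : f b + deriv f b * (a - b) ≤ f a := by
  rcases lt_trichotomy a b with h | h | h
  · obtain ⟨c, hc, hs⟩ := exists_deriv_eq_slope f h hf.continuous.continuousOn
      hf.differentiableOn
    rw [eq_div_iff (sub_pos.2 h).ne'] at hs
    nlinarith [mul_le_mul_of_nonneg_right (hmono hc.2.le) (sub_pos.2 h).le]
  · simp [h]
  · obtain ⟨c, hc, hs⟩ := exists_deriv_eq_slope f h hf.continuous.continuousOn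
      hf.differentiableOn
    rw [eq_div_iff (sub_pos.2 h).ne'] at hs
    nlinarith [mul_le_mul_of_nonneg_right (hmono hc.1.le) (sub_pos.2 h).le]

/-- A `C¹` function of the real line that factors through the retraction onto `[-X, X]` is
globally Lipschitz. -/
theorem exists_abs_sub_le_of_eq_clamp {f : ℝ → ℝ} {X : ℝ} (hX : 0 < X) (hf : ContDiff ℝ 1 f)
    (hclamp : ∀ x, f x = f (max (-X) (min X x))) :
    ∃ L, 0 ≤ L ∧ ∀ x y, |f x - f y| ≤ L * |x - y| := by
  obtain ⟨K, hK⟩ := hf.contDiffOn.exists_lipschitzOnWith one_ne_zero (convex_Icc (-X) X)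
    isCompact_Icc
  have hmem : ∀ x, max (-X) (min X x) ∈ Icc (-X) X := fun x =>
    ⟨le_max_left _ _, max_le (by linarith) (min_le_left _ _)⟩
  refine ⟨K, K.2, fun x y => ?_⟩
  rw [hclamp x, hclamp y]
  have h := hK.dist_le_mul _ (hmem x) _ (hmem y)
  rw [Real.dist_eq, Real.dist_eq] at h
  refine h.trans (mul_le_mul_of_nonneg_left ?_ K.2)
  calc |max (-X) (min X x) - max (-X) (min X y)| ≤ |min X x - min X y| := by
        simpa using abs_max_sub_max_le_max (-X) (min X x) (-X) (min X y)
    _ ≤ |x - y| := by simpa using abs_min_sub_min_le_max X x X y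

theorem FluxC3.contDiff_fst {H : ℝ → ℝ → ℝ} (h : FluxC3 H) (u : ℝ) :
    ContDiff ℝ 3 (fun x => H x u) :=
  ContDiff.comp (g := Function.uncurry H) h (contDiff_id.prodMk contDiff_const)

theorem FluxC3.contDiff_snd {H : ℝ → ℝ → ℝ} (h : FluxC3 H) (x : ℝ) : ContDiff ℝ 3 (H x) :=
  ContDiff.comp (g := Function.uncurry H) h (contDiff_const.prodMk contDiff_id)

theorem FluxC3.contDiff_deriv_fst {H : ℝ → ℝ → ℝ} (h : FluxC3 H) (u : ℝ) :
    ContDiff ℝ 1 (fun x => deriv (H x) u) := by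
  have heq : (fun x => deriv (H x) u) =
      fun x => fderiv ℝ (Function.uncurry H) (x, u) ((0 : ℝ), (1 : ℝ)) := by
    funext x
    have hd : HasFDerivAt (Function.uncurry H) (fderiv ℝ (Function.uncurry H) (x, u)) (x, u) :=
      (h.differentiable (by norm_num) (x, u)).hasFDerivAt
    exact (hd.comp_hasDerivAt u ((hasDerivAt_const u x).prodMk (hasDerivAt_id u))).deriv
  have h1 : ContDiff ℝ 1 (fderiv ℝ (Function.uncurry H)) :=
    ContDiff.fderiv_right h (by norm_num)
  rw [heq]
  exact (h1.comp (contDiff_id.prodMk contDiff_const)).clm_apply contDiff_const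

/-- Under (CH) the flux only depends on the retraction of the space variable onto `[-X, X]`. -/
theorem FluxCH.eq_clamp {H : ℝ → ℝ → ℝ} {X : ℝ} (hCH : FluxCH H X) (hC3 : FluxC3 H) (x : ℝ) :
    H x = H (max (-X) (min X x)) := by
  obtain ⟨hX, hder⟩ := hCH
  have hd : ∀ u y, X ≤ |y| → HasDerivAt (fun z => H z u) 0 y := fun u y hy => by
    rw [← hder y u hy]
    exact ((hC3.contDiff_fst u).differentiable (by norm_num) y).hasDerivAt
  funext u
  have hcont : Continuous fun z => H z u := (hC3.contDiff_fst u).continuous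
  rcases le_total X x with h | h
  · rw [min_eq_left h, max_eq_right (by linarith)]
    exact constant_of_has_deriv_right_zero hcont.continuousOn
      (fun y hy => (hd u y (hy.1.trans (le_abs_self y))).hasDerivWithinAt) x ⟨h, le_rfl⟩
  · rw [min_eq_right h]
    rcases le_total (-X) x with h' | h'
    · rw [max_eq_right h']
    · rw [max_eq_left h']
      refine (constant_of_has_deriv_right_zero hcont.continuousOn
        (fun y hy => (hd u y ?_).hasDerivWithinAt) (-X) ⟨h', le_rfl⟩).symm
      linarith [neg_le_abs y, hy.2]

/-- The critical points `α x` of the fluxes `H x` are bounded below uniformly in `x`. -/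
theorem exists_forall_le_critical_point {H : ℝ → ℝ → ℝ} {X : ℝ} (hC3 : FluxC3 H)
    (hCH : FluxCH H X) (hCVX : FluxCVX H) {α : ℝ → ℝ} (hα : ∀ x, deriv (H x) (α x) = 0) :
    ∃ m, ∀ x, m ≤ α x := by
  have hlsc : LowerSemicontinuous α := by
    intro x c hc
    have hneg : deriv (H x) c < 0 := hα x ▸ (hCVX x).1 hc
    filter_upwards [(hC3.contDiff_deriv_fst c).continuous.continuousAt.eventually_lt_const hneg]
      with y hy
    rw [← hα y] at hy
    exact (hCVX y).1.lt_iff_lt.1 hy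
  obtain ⟨m, hm⟩ := (hlsc.lowerSemicontinuousOn (Icc (-X) X)).bddBelow_of_isCompact isCompact_Icc
  refine ⟨m, fun x => ?_⟩
  have hx : α x = α (max (-X) (min X x)) := by
    apply (hCVX x).1.injective
    rw [hα x, hCH.eq_clamp hC3 x, hα]
  rw [hx]
  exact hm ⟨_, ⟨le_max_left _ _, max_le (by linarith [hCH.1]) (min_le_left _ _)⟩, rfl⟩

/-- Consistency of the interface flux at the limit: for every `k` there is `μ_k > 0`,
independent of `Δx` and `j`, with `|F^{j+1/2}(k,k) − h_{j+1}(k)| ≤ μ_k Δx`. -/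
theorem interface_flux_consistency (H : ℝ → ℝ → ℝ) (X : ℝ)
    (hC3 : FluxC3 H) (hCH : FluxCH H X) (hCVX : FluxCVX H)
    (α : ℝ → ℝ) (hα : ∀ x : ℝ, deriv (H x) (α x) = 0) (k : ℝ) :
    ∃ μ > 0, ∀ Δx > 0, ∀ j : ℤ,
      |iflux H α Δx j k k - H (((j : ℝ) + 1) * Δx) k| ≤ μ * Δx := by
  obtain ⟨L, hL0, hL⟩ := exists_abs_sub_le_of_eq_clamp hCH.1
    ((hC3.contDiff_fst k).of_le (by norm_num)) (fun x => by rw [← hCH.eq_clamp hC3 x])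
  obtain ⟨L', hL'0, hL'⟩ := exists_abs_sub_le_of_eq_clamp hCH.1 (hC3.contDiff_deriv_fst k)
    (fun x => by rw [← hCH.eq_clamp hC3 x])
  obtain ⟨m, hm⟩ := exists_forall_le_critical_point hC3 hCH hCVX hα
  have htan : ∀ x a b, H x b + deriv (H x) b * (a - b) ≤ H x a := fun x =>
    tangent_le_of_monotone_deriv ((hC3.contDiff_snd x).differentiable (by norm_num))
      (hCVX x).1.monotone
  have hmin : ∀ x a, H x (α x) ≤ H x a := fun x a => by
    simpa [hα x] using htan x a (α x)
  refine ⟨L + L' * |k - m| + 1, by positivity, fun Δx hΔ j => ?_⟩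
  unfold iflux
  have hdist : |(j : ℝ) * Δx - ((j : ℝ) + 1) * Δx| = Δx := by
    rw [show (j : ℝ) * Δx - ((j : ℝ) + 1) * Δx = -Δx by ring, abs_neg, abs_of_pos hΔ]
  generalize (j : ℝ) * Δx = x at *
  generalize ((j : ℝ) + 1) * Δx = y at *
  have hLxy := hL x y
  have hLxy' := hL' x y
  rw [hdist] at hLxy hLxy'
  have hprod : 0 ≤ L' * |k - m| * Δx := by positivity
  have hLΔ : 0 ≤ L * Δx := by positivity
  have hleft : H x (max k (α x)) ≤ H x k := by
    rcases le_total k (α x) with h | h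
    · rw [max_eq_right h]; exact hmin x k
    · rw [max_eq_left h]
  have hright : H y (min (α y) k) ≤ H y k := by
    rcases le_total k (α y) with h | h
    · rw [min_eq_right h]
    · rw [min_eq_left h]; exact hmin y k
  obtain ⟨hLxy1, hLxy2⟩ := abs_le.1 hLxy
  rw [abs_le]
  constructor
  · rcases le_total k (α y) with hy | hy
    · have := le_max_right (H x (max k (α x))) (H y (min (α y) k))
      rw [min_eq_right hy] at this ⊢
      linarith
    · rcases le_total (α x) k with hx | hx
      · have := le_max_left (H x (max k (α x))) (H y (min (α y) k))
        rw [max_eq_left hx] at this ⊢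
        linarith
      · have hx0 : deriv (H x) k ≤ 0 := hα x ▸ (hCVX x).1.monotone hx
        have hy0 : deriv (H y) k ≤ L' * Δx := by linarith [(abs_le.1 hLxy').1]
        have hkm : k - α y ≤ |k - m| := by linarith [hm y, le_abs_self (k - m)]
        have hgap : deriv (H y) k * (k - α y) ≤ L' * Δx * |k - m| :=
          mul_le_mul hy0 hkm (sub_nonneg.2 hy) (by positivity)
        have := le_max_right (H x (max k (α x))) (H y (min (α y) k))
        rw [min_eq_left hy] at this ⊢
        linarith [htan y (α y) k]
  · have := max_le (a := H x (max k (α x))) (b := H y (min (α y) k)) (c := H y k + L * Δx)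
      (by linarith) (by linarith)
    linarith
end
end

section
/- Assume H : ℝ² → ℝ satisfies (C3), (CH) and (CVX). Let m, M ∈ ℝ with m ≤ inf_ℝ α and M ≥ sup_ℝ α. Then there exist constants u̲ ≤ m and ū ≥ M, depending only on H, m and M, such that for every Δx > 0 there exist two steady states (v_j)_{j∈ℤ} and (w_j)_{j∈ℤ} of the scheme satisfying u̲ ≤ v_j ≤ m for all j ∈ ℤ and M ≤ w_j ≤ ū for all j ∈ ℤ. -/
open Real Set MeasureTheory Filter

noncomputable section

/-- `(v_j)_{j∈ℤ}` is a steady state of the scheme. -/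
def IsSteadyState (H : ℝ → ℝ → ℝ) (α : ℝ → ℝ) (Δx : ℝ) (v : ℤ → ℝ) : Prop :=
  ∀ j : ℤ, iflux H α Δx (j - 1) (v (j - 1)) (v j) = iflux H α Δx j (v j) (v (j + 1))

/-- A function whose derivative vanishes off `(-X, X)` takes only values attained on `[-X, X]`. -/
theorem eq_projIcc_of_deriv_eq_zero {f : ℝ → ℝ} {X : ℝ} (hX : 0 ≤ X) (hf : Differentiable ℝ f)
    (h : ∀ x, X ≤ |x| → deriv f x = 0) (x : ℝ) :
    f x = f (max (-X) (min X x)) := by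
  rcases le_total x (-X) with h1 | h1
  · rw [min_eq_right (by linarith), max_eq_left h1]
    refine (convex_Iic (-X)).is_const_of_fderivWithin_eq_zero hf.differentiableOn ?_ h1
      self_mem_Iic
    intro y hy
    rw [(hf y).fderivWithin (uniqueDiffOn_Iic _ y hy)]
    ext
    simpa using h y (le_abs.2 (Or.inr (by linarith [mem_Iic.1 hy])))
  · rcases le_total x X with h2 | h2
    · rw [min_eq_right h2, max_eq_right h1]
    · rw [min_eq_left h2, max_eq_right (by linarith)]
      refine (convex_Ici X).is_const_of_fderivWithin_eq_zero hf.differentiableOn ?_ h2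
        self_mem_Ici
      intro y hy
      rw [(hf y).fderivWithin (uniqueDiffOn_Ici _ y hy)]
      ext
      simpa using h y (le_abs.2 (Or.inl hy))

theorem monotoneOn_Ici_of_deriv_strictMono {f : ℝ → ℝ} (hf : Differentiable ℝ f)
    (hmono : StrictMono (deriv f)) {a : ℝ} (ha : deriv f a = 0) : MonotoneOn f (Ici a) := by
  refine monotoneOn_of_deriv_nonneg (convex_Ici a) hf.continuous.continuousOn
    hf.differentiableOn fun x hx => ?_
  rw [interior_Ici] at hx
  exact ha ▸ (hmono hx).le

theorem exists_lt_of_deriv_strictMono {f : ℝ → ℝ} (hf : Differentiable ℝ f)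
    (hmono : StrictMono (deriv f)) (hsurj : Function.Surjective (deriv f)) (M C : ℝ) :
    ∃ u, M ≤ u ∧ C < f u := by
  obtain ⟨b, hb⟩ := hsurj 1
  have key : ∀ u, b ≤ u → u - b ≤ f u - f b := fun u hu => by
    simpa using (convex_Ici b).mul_sub_le_image_sub_of_le_deriv hf.continuous.continuousOn
      hf.differentiableOn (C := 1)
      (fun x hx => by rw [interior_Ici] at hx; exact hb ▸ (hmono hx).le) b self_mem_Ici u hu hu
  refine ⟨max (max b M) (b + (C - f b) + 1), (le_max_right b M).trans (le_max_left _ _), ?_⟩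
  have h1 := key _ ((le_max_left b M).trans (le_max_left _ (b + (C - f b) + 1)))
  linarith [le_max_right (max b M) (b + (C - f b) + 1)]

/-- A level `C` reached by all the functions `G x` at a uniformly bounded height above `M`. -/
theorem exists_common_level {G : ℝ → ℝ → ℝ} {X : ℝ} (hX : 0 ≤ X)
    (hG : Differentiable ℝ (Function.uncurry G))
    (hconst : ∀ x u, X ≤ |x| → deriv (fun y => G y u) x = 0)
    (hmono : ∀ x, StrictMono (deriv (G x)))
    (hsurj : ∀ x, Function.Surjective (deriv (G x)))
    {α : ℝ → ℝ} (hα : ∀ x, deriv (G x) (α x) = 0) {M : ℝ} (hM : ∀ x, α x ≤ M) :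
    ∃ C U, M ≤ U ∧ ∀ x, G x (α x) ≤ C ∧ ∃ w ∈ Icc M U, G x w = C := by
  have hdu (x : ℝ) : Differentiable ℝ (G x) :=
    hG.comp (f := fun u : ℝ => (x, u)) (by fun_prop)
  have hdx (u : ℝ) : Differentiable ℝ (fun y => G y u) :=
    hG.comp (f := fun y : ℝ => (y, u)) (by fun_prop)
  have hclamp (x : ℝ) : ∃ y ∈ Icc (-X) X, ∀ u, G x u = G y u :=
    ⟨max (-X) (min X x), ⟨le_max_left _ _, max_le (by linarith) (min_le_left _ _)⟩,
      fun u => eq_projIcc_of_deriv_eq_zero hX (hdx u) (fun y => hconst y u) x⟩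
  have hup (x : ℝ) : MonotoneOn (G x) (Ici M) :=
    (monotoneOn_Ici_of_deriv_strictMono (hdu x) (hmono x) (hα x)).mono
      (Ici_subset_Ici.2 (hM x))
  obtain ⟨C, hC⟩ := isCompact_Icc.bddAbove_image (K := Icc (-X) X)
    (hdx M).continuous.continuousOn
  have hC' (x : ℝ) : G x M ≤ C := by
    obtain ⟨y, hy, h⟩ := hclamp x
    exact h M ▸ hC (mem_image_of_mem _ hy)
  choose U hMU hU using fun x => exists_lt_of_deriv_strictMono (hdu x) (hmono x) (hsurj x) M C
  obtain ⟨t, -, ht⟩ := isCompact_Icc.elim_nhds_subcover (s := Icc (-X) X)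
    (fun x => {y | C < G y (U x)})
    (fun x _ => (isOpen_lt continuous_const (hdx (U x)).continuous).mem_nhds (hU x))
  obtain ⟨B, hB⟩ := (t.image U).bddAbove
  refine ⟨C, max M B, le_max_left _ _, fun x => ⟨?_, ?_⟩⟩
  · exact (monotoneOn_Ici_of_deriv_strictMono (hdu x) (hmono x) (hα x) self_mem_Ici (hM x)
      (hM x)).trans (hC' x)
  · obtain ⟨y, hy, h⟩ := hclamp x
    obtain ⟨z, hz, hyz⟩ := mem_iUnion₂.1 (ht hy)
    have hzB : U z ≤ max M B :=
      (hB (Finset.mem_coe.2 (Finset.mem_image_of_mem U hz))).trans (le_max_right _ _)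
    have hCU : C ≤ G x (max M B) :=
      calc C ≤ G y (U z) := le_of_lt hyz
        _ = G x (U z) := (h _).symm
        _ ≤ G x (max M B) := hup x (hMU z) (le_max_left M B) hzB
    exact intermediate_value_Icc (le_max_left _ _) (hdu x).continuous.continuousOn ⟨hC' x, hCU⟩

theorem isSteadyState_of_iflux_eq {H : ℝ → ℝ → ℝ} {α : ℝ → ℝ} {Δx C : ℝ} {v : ℤ → ℝ}
    (h : ∀ j : ℤ, iflux H α Δx j (v j) (v (j + 1)) = C) : IsSteadyState H α Δx v := fun j => by
  have := h (j - 1)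
  rw [sub_add_cancel] at this
  rw [this, h j]

/-- Existence of bounded steady states of the scheme below `m` and above `M`. -/
theorem bounded_steady_states (H : ℝ → ℝ → ℝ) (X : ℝ)
    (hC3 : FluxC3 H) (hCH : FluxCH H X) (hCVX : FluxCVX H)
    (α : ℝ → ℝ) (hα : ∀ x : ℝ, deriv (H x) (α x) = 0)
    (m M : ℝ) (hm : ∀ x : ℝ, m ≤ α x) (hM : ∀ x : ℝ, α x ≤ M) :
    ∃ ulo uhi : ℝ, ulo ≤ m ∧ M ≤ uhi ∧
      ∀ Δx : ℝ, 0 < Δx →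
        ∃ v w : ℤ → ℝ, IsSteadyState H α Δx v ∧ IsSteadyState H α Δx w ∧
          (∀ j : ℤ, ulo ≤ v j ∧ v j ≤ m) ∧ (∀ j : ℤ, M ≤ w j ∧ w j ≤ uhi) := by
  have hd : Differentiable ℝ (Function.uncurry H) := hC3.differentiable (by norm_num)
  obtain ⟨hX, hconst⟩ := hCH
  have hderiv (x : ℝ) : deriv (fun u => H x (-u)) = fun u => -deriv (H x) (-u) :=
    funext fun u => deriv_comp_neg (H x) u
  obtain ⟨C, U, hMU, hC⟩ := exists_common_level hX.le hd hconst (fun x => (hCVX x).1)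
    (fun x => (hCVX x).2.1.2) hα hM
  obtain ⟨D, L, hmL, hD⟩ := exists_common_level (G := fun x u => H x (-u)) hX.le
    (hd.comp (f := fun p : ℝ × ℝ => (p.1, -p.2)) (by fun_prop))
    (fun x u => hconst x (-u))
    (fun x u v huv => by
      simpa only [hderiv, neg_lt_neg_iff] using (hCVX x).1 (neg_lt_neg huv))
    (fun x y => by
      obtain ⟨u, hu⟩ := (hCVX x).2.1.2 (-y)
      exact ⟨-u, by simp [hderiv, hu]⟩)
    (α := fun x => -α x) (fun x => by simp [hderiv, hα])
    (M := -m) (fun x => neg_le_neg (hm x))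
  simp only [neg_neg] at hD
  choose hαC w hw hwC using hC
  choose hαD v hv hvD using hD
  refine ⟨-L, U, by linarith, hMU, fun Δx _ => ⟨fun j => -v (j * Δx), fun j => w (j * Δx),
    ?_, ?_, fun j => ?_, fun j => hw _⟩⟩
  · refine isSteadyState_of_iflux_eq (C := D) fun j => ?_
    have h1 := hm (j * Δx)
    have h2 := hm ((j + 1) * Δx)
    have h3 := (hv (j * Δx)).1
    have h4 := (hv ((j + 1) * Δx)).1
    simp only [iflux, Int.cast_add, Int.cast_one]
    rw [max_eq_right (by linarith : -v (j * Δx) ≤ α (j * Δx)),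
      min_eq_right (by linarith : -v ((j + 1) * Δx) ≤ α ((j + 1) * Δx)), hvD,
      max_eq_right (hαD _)]
  · refine isSteadyState_of_iflux_eq (C := C) fun j => ?_
    have h1 := (hM (j * Δx)).trans (hw (j * Δx)).1
    have h2 := (hM ((j + 1) * Δx)).trans (hw ((j + 1) * Δx)).1
    simp only [iflux, Int.cast_add, Int.cast_one]
    rw [max_eq_left h1, min_eq_left h2, hwC, max_eq_left (hαC _)]
  · exact ⟨by linarith [(hv (j * Δx)).2], by linarith [(hv (j * Δx)).1]⟩
end
end

section
/- Assume H : ℝ² → ℝ satisfies (C3), (CH) and (CVX). Fix u̲ ≤ ū, and suppose Δx, Δt > 0 satisfy the CFL condition 2λL ≤ 1 with λ := Δt/Δx and L := sup{ |∂ᵤH(x,p)| : x ∈ ℝ, u̲ ≤ p ≤ ū }. Let (u_j^n)_j ⊂ [u̲,ū] and define u_j^{n+1} by the scheme. Then for every k ∈ [u̲,ū] and every j ∈ ℤ, the discrete entropy inequality holds: (|u_j^{n+1} − k| − |u_j^n − k|) Δx + (Φ^n_{j+1/2} − Φ^n_{j−1/2}) Δt ≤ − sgn(u_j^{n+1} −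 k) (F^{j+1/2}(k,k) − F^{j−1/2}(k,k)) Δt, where Φ^n_{j+1/2} := F^{j+1/2}(max(u_j^n,k), max(u_{j+1}^n,k)) − F^{j+1/2}(min(u_j^n,k), min(u_{j+1}^n,k)). -/
open Real Set MeasureTheory Filter

noncomputable section

/-- One step of the scheme applied to the time level `u : ℤ → ℝ`:
`u_j^{n+1} = u_j^n − (Δt/Δx)(F^{j+1/2}(u_j,u_{j+1}) − F^{j−1/2}(u_{j−1},u_j))`. -/
def schemeStep (H : ℝ → ℝ → ℝ) (α : ℝ → ℝ) (Δx Δt : ℝ) (u : ℤ → ℝ) (j : ℤ) : ℝ :=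
  u j - (Δt / Δx) * (iflux H α Δx j (u j) (u (j + 1)) -
    iflux H α Δx (j - 1) (u (j - 1)) (u j))

/-- The numerical entropy flux `Φ^n_{j+1/2}`. -/
def numEntFlux (H : ℝ → ℝ → ℝ) (α : ℝ → ℝ) (Δx : ℝ) (u : ℤ → ℝ) (k : ℝ) (j : ℤ) : ℝ :=
  iflux H α Δx j (max (u j) k) (max (u (j + 1)) k) -
    iflux H α Δx j (min (u j) k) (min (u (j + 1)) k)

lemma FluxC3.differentiable_left {H : ℝ → ℝ → ℝ} (hC3 : FluxC3 H) (u : ℝ) :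
    Differentiable ℝ (fun y => H y u) := by
  have h : Differentiable ℝ (Function.uncurry H) := hC3.differentiable (by norm_num)
  exact h.comp (differentiable_id.prodMk (differentiable_const u))

lemma FluxC3.differentiable_right {H : ℝ → ℝ → ℝ} (hC3 : FluxC3 H) (x : ℝ) :
    Differentiable ℝ (H x) := by
  have h : Differentiable ℝ (Function.uncurry H) := hC3.differentiable (by norm_num)
  exact h.comp ((differentiable_const x).prodMk differentiable_id)

lemma FluxC3.continuous_deriv {H : ℝ → ℝ → ℝ} (hC3 : FluxC3 H) :
    Continuous (fun q : ℝ × ℝ => deriv (H q.1) q.2) := by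
  have hd : Differentiable ℝ (Function.uncurry H) := hC3.differentiable (by norm_num)
  have heq : (fun q : ℝ × ℝ => deriv (H q.1) q.2) =
      fun q => fderiv ℝ (Function.uncurry H) q (0, 1) := by
    funext q
    have hline : HasDerivAt (fun p : ℝ => (q.1, p)) ((0 : ℝ), (1 : ℝ)) q.2 :=
      (hasDerivAt_const q.2 q.1).prodMk (hasDerivAt_id q.2)
    exact ((hd q).hasFDerivAt.comp_hasDerivAt q.2 hline).deriv
  rw [heq]
  exact (hC3.continuous_fderiv (by norm_num)).clm_apply continuous_const

/-- Outside the heterogeneity region the flux equals its value at the nearest endpoint. -/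
lemma FluxCH.exists_eq_of_mem_Icc {H : ℝ → ℝ → ℝ} {X : ℝ} (hC3 : FluxC3 H) (hCH : FluxCH H X)
    (x : ℝ) : ∃ y ∈ Icc (-X) X, H x = H y := by
  obtain ⟨hX, hconst⟩ := hCH
  have key : ∀ s : Set ℝ, Convex ℝ s → (∀ y ∈ s, X ≤ |y|) → ∀ y ∈ s, ∀ z ∈ s, H z = H y := by
    intro s hs hsX y hy z hz
    funext u
    have := hs.norm_image_sub_le_of_norm_deriv_le (f := fun y => H y u) (C := 0)
      (fun w _ => hC3.differentiable_left u w)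
      (fun w hw => by rw [hconst w u (hsX w hw), norm_zero]) hy hz
    rw [zero_mul] at this
    exact sub_eq_zero.mp (norm_le_zero_iff.mp this)
  rcases le_total X x with h | h
  · exact ⟨X, ⟨by linarith, le_rfl⟩,
      key (Ici X) (convex_Ici X) (fun y hy => le_trans hy (le_abs_self y)) X self_mem_Ici x h⟩
  · rcases le_total x (-X) with h' | h'
    · exact ⟨-X, ⟨le_rfl, by linarith⟩,
        key (Iic (-X)) (convex_Iic _)
          (fun y hy => le_trans (le_neg.mp hy) (neg_le_abs y)) (-X) self_mem_Iic x h'⟩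
    · exact ⟨x, ⟨h', h⟩, rfl⟩

lemma FluxCH.bddAbove_abs_deriv {H : ℝ → ℝ → ℝ} {X : ℝ} (hC3 : FluxC3 H) (hCH : FluxCH H X)
    (a b : ℝ) : BddAbove {y : ℝ | ∃ x p : ℝ, a ≤ p ∧ p ≤ b ∧ y = |deriv (H x) p|} := by
  refine (((isCompact_Icc (a := -X) (b := X)).prod (isCompact_Icc (a := a) (b := b))).image
    hC3.continuous_deriv.abs).bddAbove.mono ?_
  rintro _ ⟨x, p, hap, hpb, rfl⟩
  obtain ⟨y, hy, hxy⟩ := hCH.exists_eq_of_mem_Icc hC3 x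
  exact ⟨(y, p), ⟨hy, hap, hpb⟩, by simp [hxy]⟩

section OneVariable

variable {h : ℝ → ℝ} {m L lo hi : ℝ}

lemma monotone_comp_max_of_deriv (hd : Differentiable ℝ h) (hmono : StrictMono (deriv h))
    (hm : deriv h m = 0) : Monotone (fun a => h (max a m)) := by
  have hon : MonotoneOn h (Ici m) :=
    monotoneOn_of_deriv_nonneg (convex_Ici m) hd.continuous.continuousOn hd.differentiableOn
      (fun x hx => hm ▸ hmono.monotone (mem_Ici.mp (interior_subset hx)))
  exact fun a b hab => hon (mem_Ici.mpr (le_max_right _ _)) (mem_Ici.mpr (le_max_right _ _))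
    (max_le_max_right m hab)

lemma antitone_comp_min_of_deriv (hd : Differentiable ℝ h) (hmono : StrictMono (deriv h))
    (hm : deriv h m = 0) : Antitone (fun a => h (min m a)) := by
  have hon : AntitoneOn h (Iic m) :=
    antitoneOn_of_deriv_nonpos (convex_Iic m) hd.continuous.continuousOn hd.differentiableOn
      (fun x hx => hm ▸ hmono.monotone (mem_Iic.mp (interior_subset hx)))
  exact fun a b hab => hon (mem_Iic.mpr (min_le_left _ _)) (mem_Iic.mpr (min_le_left _ _))
    (min_le_min_left m hab)

lemma abs_sub_le_of_abs_deriv_le (hd : Differentiable ℝ h)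
    (hL : ∀ p ∈ Icc lo hi, |deriv h p| ≤ L) {a b : ℝ} (ha : a ∈ Icc lo hi) (hb : b ∈ Icc lo hi)
    (hab : a ≤ b) : |h b - h a| ≤ L * (b - a) := by
  have := (convex_Icc lo hi).norm_image_sub_le_of_norm_deriv_le (fun w _ => hd w) hL ha hb
  rwa [Real.norm_eq_abs, Real.norm_eq_abs, abs_of_nonneg (sub_nonneg.mpr hab)] at this

lemma comp_max_sub_le (hd : Differentiable ℝ h) (hL0 : 0 ≤ L)
    (hL : ∀ p ∈ Icc lo hi, |deriv h p| ≤ L) {a b : ℝ} (ha : a ∈ Icc lo hi) (hb : b ∈ Icc lo hi)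
    (hab : a ≤ b) : h (max b m) - h (max a m) ≤ L * (b - a) := by
  rcases le_total b m with hbm | hbm
  · rw [max_eq_right hbm, max_eq_right (hab.trans hbm), sub_self]
    exact mul_nonneg hL0 (sub_nonneg.mpr hab)
  · have hmem : max a m ∈ Icc lo hi :=
      ⟨ha.1.trans (le_max_left _ _), max_le ha.2 (hbm.trans hb.2)⟩
    rw [max_eq_left hbm]
    refine (le_abs_self _).trans ((abs_sub_le_of_abs_deriv_le hd hL hmem hb (max_le hab hbm)).trans
      (mul_le_mul_of_nonneg_left ?_ hL0))
    linarith [le_max_left a m]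

lemma comp_min_sub_le (hd : Differentiable ℝ h) (hL0 : 0 ≤ L)
    (hL : ∀ p ∈ Icc lo hi, |deriv h p| ≤ L) {a b : ℝ} (ha : a ∈ Icc lo hi) (hb : b ∈ Icc lo hi)
    (hab : a ≤ b) : h (min m a) - h (min m b) ≤ L * (b - a) := by
  rcases le_total m a with hma | hma
  · rw [min_eq_left hma, min_eq_left (hma.trans hab), sub_self]
    exact mul_nonneg hL0 (sub_nonneg.mpr hab)
  · have hmem : min m b ∈ Icc lo hi :=
      ⟨le_min (ha.1.trans hma) hb.1, (min_le_right _ _).trans hb.2⟩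
    rw [min_eq_right hma]
    refine (neg_sub (h (min m b)) (h a) ▸ neg_le_abs _).trans
      ((abs_sub_le_of_abs_deriv_le hd hL ha hmem (le_min hma hab)).trans
        (mul_le_mul_of_nonneg_left ?_ hL0))
    linarith [min_le_right m b]

end OneVariable

section InterfaceFlux

variable {H : ℝ → ℝ → ℝ} {α : ℝ → ℝ} {Δx L lo hi : ℝ}

lemma iflux_le_iflux (hd : ∀ x, Differentiable ℝ (H x)) (hmono : ∀ x, StrictMono (deriv (H x)))
    (hα : ∀ x, deriv (H x) (α x) = 0) (j : ℤ) {a a' b b' : ℝ} (ha : a ≤ a') (hb : b' ≤ b) :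
    iflux H α Δx j a b ≤ iflux H α Δx j a' b' :=
  max_le_max (monotone_comp_max_of_deriv (hd _) (hmono _) (hα _) ha)
    (antitone_comp_min_of_deriv (hd _) (hmono _) (hα _) hb)

lemma iflux_sub_le_left (hd : ∀ x, Differentiable ℝ (H x)) (hL0 : 0 ≤ L)
    (hL : ∀ x, ∀ p ∈ Icc lo hi, |deriv (H x) p| ≤ L) (j : ℤ) {a a' : ℝ} (b : ℝ)
    (ha : a ∈ Icc lo hi) (ha' : a' ∈ Icc lo hi) (haa' : a ≤ a') :
    iflux H α Δx j a' b - iflux H α Δx j a b ≤ L * (a' - a) := by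
  have hnonneg : 0 ≤ L * (a' - a) := mul_nonneg hL0 (sub_nonneg.mpr haa')
  have := comp_max_sub_le (m := α (j * Δx)) (hd (j * Δx)) hL0 (hL _) ha ha' haa'
  unfold iflux
  rw [sub_le_iff_le_add]
  refine max_le ?_ ?_
  · linarith [le_max_left (H (j * Δx) (max a (α (j * Δx))))
      (H ((j + 1) * Δx) (min (α ((j + 1) * Δx)) b))]
  · linarith [le_max_right (H (j * Δx) (max a (α (j * Δx))))
      (H ((j + 1) * Δx) (min (α ((j + 1) * Δx)) b))]

lemma iflux_sub_le_right (hd : ∀ x, Differentiable ℝ (H x)) (hL0 : 0 ≤ L)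
    (hL : ∀ x, ∀ p ∈ Icc lo hi, |deriv (H x) p| ≤ L) (j : ℤ) (a : ℝ) {b b' : ℝ}
    (hb : b ∈ Icc lo hi) (hb' : b' ∈ Icc lo hi) (hbb' : b ≤ b') :
    iflux H α Δx j a b - iflux H α Δx j a b' ≤ L * (b' - b) := by
  have hnonneg : 0 ≤ L * (b' - b) := mul_nonneg hL0 (sub_nonneg.mpr hbb')
  have := comp_min_sub_le (m := α ((j + 1) * Δx)) (hd ((j + 1) * Δx)) hL0 (hL _) hb hb' hbb'
  unfold iflux
  rw [sub_le_iff_le_add]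
  refine max_le ?_ ?_
  · linarith [le_max_left (H (j * Δx) (max a (α (j * Δx))))
      (H ((j + 1) * Δx) (min (α ((j + 1) * Δx)) b'))]
  · linarith [le_max_right (H (j * Δx) (max a (α (j * Δx))))
      (H ((j + 1) * Δx) (min (α ((j + 1) * Δx)) b'))]

/-- Under the CFL condition the scheme is monotone on `[lo, hi]`-valued data. -/
lemma schemeStep_mono {Δt : ℝ} (hd : ∀ x, Differentiable ℝ (H x))
    (hmono : ∀ x, StrictMono (deriv (H x))) (hα : ∀ x, deriv (H x) (α x) = 0) (hL0 : 0 ≤ L)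
    (hL : ∀ x, ∀ p ∈ Icc lo hi, |deriv (H x) p| ≤ L) (hΔ : 0 ≤ Δt / Δx)
    (hCFL : 2 * (Δt / Δx) * L ≤ 1) {v w : ℤ → ℝ} (hv : ∀ i, v i ∈ Icc lo hi)
    (hw : ∀ i, w i ∈ Icc lo hi) (hvw : ∀ i, v i ≤ w i) (j : ℤ) :
    schemeStep H α Δx Δt v j ≤ schemeStep H α Δx Δt w j := by
  have h₁ : iflux H α Δx j (w j) (w (j + 1)) ≤ iflux H α Δx j (w j) (v (j + 1)) :=
    iflux_le_iflux hd hmono hα j le_rfl (hvw _)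
  have h₂ := iflux_sub_le_left (α := α) (Δx := Δx) hd hL0 hL j (v (j + 1)) (hv j) (hw j) (hvw j)
  have h₃ : iflux H α Δx (j - 1) (v (j - 1)) (w j) ≤ iflux H α Δx (j - 1) (w (j - 1)) (w j) :=
    iflux_le_iflux hd hmono hα (j - 1) (hvw _) le_rfl
  have h₄ := iflux_sub_le_right (α := α) (Δx := Δx) hd hL0 hL (j - 1) (v (j - 1))
    (hv j) (hw j) (hvw j)
  have hflux : (iflux H α Δx j (w j) (w (j + 1)) - iflux H α Δx (j - 1) (w (j - 1)) (w j)) -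
      (iflux H α Δx j (v j) (v (j + 1)) - iflux H α Δx (j - 1) (v (j - 1)) (v j)) ≤
      2 * L * (w j - v j) := by linarith
  have h₅ := mul_le_mul_of_nonneg_left hflux hΔ
  have h₆ := mul_le_mul_of_nonneg_right hCFL (sub_nonneg.mpr (hvw j))
  unfold schemeStep
  linarith

end InterfaceFlux

lemma abs_add_sign_mul_le_abs_add (x y : ℝ) : |x| + Real.sign x * y ≤ |x + y| := by
  rcases lt_trichotomy x 0 with hx | rfl | hx
  · rw [Real.sign_of_neg hx, abs_of_neg hx]
    linarith [neg_le_abs (x + y)]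
  · simp
  · rw [Real.sign_of_pos hx, abs_of_pos hx]
    linarith [le_abs_self (x + y)]

/-- Discrete entropy inequalities for the scheme under the CFL condition. -/
theorem discrete_entropy_inequality (H : ℝ → ℝ → ℝ) (X : ℝ)
    (hC3 : FluxC3 H) (hCH : FluxCH H X) (hCVX : FluxCVX H)
    (α : ℝ → ℝ) (hα : ∀ x : ℝ, deriv (H x) (α x) = 0)
    (ulo uhi : ℝ) (hlo : ulo ≤ uhi) (Δx Δt : ℝ) (hΔx : 0 < Δx) (hΔt : 0 < Δt)
    (hCFL : 2 * (Δt / Δx) *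
      sSup {y : ℝ | ∃ x p : ℝ, ulo ≤ p ∧ p ≤ uhi ∧ y = |deriv (H x) p|} ≤ 1)
    (u : ℤ → ℝ) (hu : ∀ j : ℤ, u j ∈ Set.Icc ulo uhi)
    (k : ℝ) (hk : k ∈ Set.Icc ulo uhi) (j : ℤ) :
    (|schemeStep H α Δx Δt u j - k| - |u j - k|) * Δx +
        (numEntFlux H α Δx u k j - numEntFlux H α Δx u k (j - 1)) * Δt ≤
      -(Real.sign (schemeStep H α Δx Δt u j - k) *
          (iflux H α Δx j k k - iflux H α Δx (j - 1) k k)) * Δt := by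
  set L := sSup {y : ℝ | ∃ x p : ℝ, ulo ≤ p ∧ p ≤ uhi ∧ y = |deriv (H x) p|}
  have hL : ∀ x, ∀ p ∈ Icc ulo uhi, |deriv (H x) p| ≤ L := fun x p hp =>
    le_csSup (hCH.bddAbove_abs_deriv hC3 ulo uhi) ⟨x, p, hp.1, hp.2, rfl⟩
  have hL0 : 0 ≤ L := (abs_nonneg _).trans (hL 0 ulo ⟨le_rfl, hlo⟩)
  have hmono : ∀ {v w : ℤ → ℝ}, (∀ i, v i ∈ Icc ulo uhi) → (∀ i, w i ∈ Icc ulo uhi) →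
      (∀ i, v i ≤ w i) → schemeStep H α Δx Δt v j ≤ schemeStep H α Δx Δt w j :=
    fun hv hw hvw => schemeStep_mono hC3.differentiable_right (fun x => (hCVX x).1) hα hL0 hL
      (div_pos hΔt hΔx).le hCFL hv hw hvw j
  have hmax : ∀ i, max (u i) k ∈ Icc ulo uhi := fun i =>
    ⟨(hu i).1.trans (le_max_left _ _), max_le (hu i).2 hk.2⟩
  have hmin : ∀ i, min (u i) k ∈ Icc ulo uhi := fun i =>
    ⟨le_min (hu i).1 hk.1, (min_le_left _ _).trans (hu i).2⟩
  have hu_max := hmono hu hmax fun i => le_max_left _ _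
  have hk_max := hmono (fun _ => hk) hmax fun i => le_max_right (u i) k
  have hu_min := hmono hmin hu fun i => min_le_left _ _
  have hk_min := hmono hmin (fun _ => hk) fun i => min_le_right (u i) k
  have habs : |schemeStep H α Δx Δt u j - schemeStep H α Δx Δt (fun _ => k) j| ≤
      schemeStep H α Δx Δt (fun i => max (u i) k) j -
        schemeStep H α Δx Δt (fun i => min (u i) k) j :=
    abs_le.mpr ⟨by linarith, by linarith⟩
  have hdiff : schemeStep H α Δx Δt (fun i => max (u i) k) j -
      schemeStep H α Δx Δt (fun i => min (u i) k) j =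
      |u j - k| - Δt / Δx * (numEntFlux H α Δx u k j - numEntFlux H α Δx u k (j - 1)) := by
    rw [← max_sub_min_eq_abs']
    simp only [schemeStep, numEntFlux, sub_add_cancel]
    ring
  have hshift : schemeStep H α Δx Δt u j - schemeStep H α Δx Δt (fun _ => k) j =
      (schemeStep H α Δx Δt u j - k) +
        Δt / Δx * (iflux H α Δx j k k - iflux H α Δx (j - 1) k k) := by
    simp only [schemeStep]
    ring
  rw [hdiff, hshift] at habs
  have hmul := mul_le_mul_of_nonneg_right
    ((abs_add_sign_mul_le_abs_add _ _).trans habs) hΔx.le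
  have hcancel : Δt / Δx * Δx = Δt := div_mul_cancel₀ Δt hΔx.ne'
  generalize schemeStep H α Δx Δt u j - k = e at hmul ⊢
  generalize numEntFlux H α Δx u k j - numEntFlux H α Δx u k (j - 1) = φ at hmul ⊢
  generalize iflux H α Δx j k k - iflux H α Δx (j - 1) k k = d at hmul ⊢
  rw [← hcancel]
  linarith
end
end
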